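/- Let γ ∈ ℂ. There is r0 ∈ (0,1) such that for every r ∈ (0,r0), all integers y1 < y2 and x1 ≤ x2 ≤ x3 ≤ x4 with x1 < x4, and every a ∈ {↑,↓}⁴: ∮_{|z1|=r³} ∮_{|z2|=r²} ∮_{|z3|=r} ∮_{|z4|=1} [Y_{3,4}(s(z1)−s(z3)) Y_{2,3}(s(z1)−s(z4)) I4](a) · (s(z1)−s(z2))/(s(z1)−s(z2)−2γ) · (s(z3)−s(z4))/(s(z3)−s(z4)−2γ) · z2^{x1−y1} z4^{x2−y2} z3^{x3−y2} z1^{x4−y1} dz4/(2πiz4) dz3/(2πiz3) dz2/(2πiz2) dz1/(2πiz1) = 0. -/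

import Mathlib

/-- Spin index `{↑,↓}`. -/
inductive Spin : Type
  | up : Spin
  | down : Spin
  deriving DecidableEq

/-- `ε(↓,↑) = 1`, `ε(↑,↓) = -1`, `ε(↑,↑) = ε(↓,↓) = 0`. -/
def epsS : Spin → Spin → ℂ
  | Spin.down, Spin.up => 1
  | Spin.up, Spin.down => -1
  | _, _ => 0

/-- `(ℂ²)^{⊗4}`, identified with functions `{↑,↓}⁴ → ℂ`. -/
abbrev V4 : Type := (Fin 4 → Spin) → ℂ

/-- The transposition operator `Π_{j,l}` acting on `(ℂ²)^{⊗4}`. -/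
def Pi4 (j l : Fin 4) (w : V4) : V4 := fun a => w (a ∘ Equiv.swap j l)

/-- The Yang operator `Y_{j,l}(λ) = (λΠ_{j,l} - 2γ·Id)/(λ - 2γ)` on `(ℂ²)^{⊗4}`. -/
noncomputable def Y4 (γ : ℂ) (j l : Fin 4) (lam : ℂ) (w : V4) : V4 :=
  fun a => (lam * Pi4 j l w a - 2 * γ * w a) / (lam - 2 * γ)

/-- The vector `I4` with components `I4(a1,a2,a3,a4) = ε(a1,a2)·ε(a3,a4)`. -/
def I4 : V4 := fun a => epsS (a 0) (a 1) * epsS (a 2) (a 3)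

/-- `s(z) = (z - 1/z)/(2i)`. -/
noncomputable def sfun (z : ℂ) : ℂ := (z - z⁻¹) / (2 * Complex.I)

/-- `∮_{|z|=ρ} f(z) dz/(2πiz)`: the normalized contour integral over the counterclockwise
circle of radius `ρ` centered at the origin. -/
noncomputable def cint (ρ : ℝ) (f : ℂ → ℂ) : ℂ :=
  (2 * Real.pi * Complex.I)⁻¹ * (∮ z in C(0, ρ), f z / z)

theorem cint_eq_intervalIntegral {ρ : ℝ} (hρ : ρ ≠ 0) (f : ℂ → ℂ) :
    cint ρ f = (2 * Real.pi : ℂ)⁻¹ * ∫ θ in (0 : ℝ)..2 * Real.pi, f (circleMap 0 ρ θ) := by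
  have h : (∮ z in C(0, ρ), f z / z)
      = Complex.I * ∫ θ in (0 : ℝ)..2 * Real.pi, f (circleMap 0 ρ θ) := by
    rw [circleIntegral, ← intervalIntegral.integral_const_mul]
    refine intervalIntegral.integral_congr fun θ _ => ?_
    have h0 : circleMap 0 ρ θ ≠ 0 := circleMap_ne_center hρ
    simp only [deriv_circleMap, smul_eq_mul]
    field_simp
  rw [cint, h, mul_inv, mul_assoc, inv_mul_cancel_left₀ Complex.I_ne_zero]

theorem cint_congr {ρ : ℝ} (hρ : 0 < ρ) {f g : ℂ → ℂ} (h : ∀ z, ‖z‖ = ρ → f z = g z) :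
    cint ρ f = cint ρ g := by
  rw [cint_eq_intervalIntegral hρ.ne', cint_eq_intervalIntegral hρ.ne']
  congr 1
  refine intervalIntegral.integral_congr fun θ _ => h _ ?_
  rw [norm_circleMap_zero, abs_of_pos hρ]

/-- The substitution `w = z₁ z` in a normalized contour integral. -/
theorem cint_eq_cint_div {ρ₁ ρ₂ : ℝ} (h₁ : 0 < ρ₁) (h₂ : 0 < ρ₂) {z₁ : ℂ} (hz : ‖z₁‖ = ρ₁)
    (f : ℂ → ℂ) : cint ρ₂ f = cint (ρ₁ * ρ₂) fun w => f (w / z₁) := by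
  rw [cint_eq_intervalIntegral h₂.ne', cint_eq_intervalIntegral (mul_pos h₁ h₂).ne']
  congr 1
  have hz' : z₁ = circleMap 0 ρ₁ z₁.arg := by
    rw [circleMap_zero, ← hz, Complex.norm_mul_exp_arg_mul_I]
  have key : ∀ θ : ℝ, circleMap 0 (ρ₁ * ρ₂) θ / z₁ = circleMap 0 ρ₂ (θ - z₁.arg) := by
    intro θ
    conv_lhs => rw [hz']
    rw [circleMap_zero_div, mul_div_cancel_left₀ _ h₁.ne']
  simp only [key]
  rw [intervalIntegral.integral_comp_sub_right (fun θ => f (circleMap 0 ρ₂ θ))]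
  have hp : Function.Periodic (fun θ => f (circleMap 0 ρ₂ θ)) (2 * Real.pi) := fun θ => by
    simp only [periodic_circleMap 0 ρ₂ θ]
  have := hp.intervalIntegral_add_eq 0 (0 - z₁.arg)
  rw [zero_add] at this
  rw [this]
  congr 1
  ring

theorem continuous_cint {X : Type*} [TopologicalSpace X] {ρ : ℝ} (hρ : ρ ≠ 0) {f : X → ℂ → ℂ}
    (hf : Continuous fun p : X × ℝ => f p.1 (circleMap 0 ρ p.2)) :
    Continuous fun x => cint ρ (f x) := by
  simp only [cint_eq_intervalIntegral hρ]
  exact continuous_const.mul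
    (intervalIntegral.continuous_parametric_intervalIntegral_of_continuous' hf _ _)

theorem intervalIntegral.integral_comm_of_continuous {f : ℝ → ℝ → ℂ} {a b c d : ℝ}
    (hf : Continuous fun p : ℝ × ℝ => f p.1 p.2) :
    ∫ x in a..b, ∫ y in c..d, f x y = ∫ y in c..d, ∫ x in a..b, f x y := by
  simp only [intervalIntegral.intervalIntegral_eq_integral_uIoc,
    MeasureTheory.integral_smul]
  rw [smul_comm, MeasureTheory.integral_integral_swap]
  rw [MeasureTheory.Measure.prod_restrict]
  refine (hf.continuousOn.integrableOn_compact
    (isCompact_uIcc.prod isCompact_uIcc)).mono_set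
    (Set.prod_mono Set.uIoc_subset_uIcc Set.uIoc_subset_uIcc)

theorem cint_comm {ρ₁ ρ₂ : ℝ} (h₁ : ρ₁ ≠ 0) (h₂ : ρ₂ ≠ 0) {f : ℂ → ℂ → ℂ}
    (hf : Continuous fun p : ℝ × ℝ => f (circleMap 0 ρ₁ p.1) (circleMap 0 ρ₂ p.2)) :
    (cint ρ₁ fun z => cint ρ₂ fun w => f z w) = cint ρ₂ fun w => cint ρ₁ fun z => f z w := by
  simp only [cint_eq_intervalIntegral h₁, cint_eq_intervalIntegral h₂,
    intervalIntegral.integral_const_mul]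
  rw [intervalIntegral.integral_comm_of_continuous hf, mul_left_comm]

/-- The numerator of `s(z) - σ` after multiplication by `2iz`. -/
theorem sfun_eq {z : ℂ} (hz : z ≠ 0) : z * (2 * Complex.I) * sfun z = z ^ 2 - 1 := by
  have := Complex.I_ne_zero
  rw [sfun]
  field_simp

theorem norm_two_I_mul_sfun_le (z : ℂ) : ‖2 * Complex.I * sfun z‖ ≤ ‖z‖ + ‖z‖⁻¹ := by
  have : 2 * Complex.I * sfun z = z - z⁻¹ := by
    rw [sfun]; field_simp [Complex.I_ne_zero]
  rw [this]
  exact (norm_sub_le _ _).trans (by rw [norm_inv])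

/-- The function `2iz (s(z) - σ)`, which extends analytically across `z = 0`. -/
noncomputable def sNum (σ z : ℂ) : ℂ := z ^ 2 - 1 - z * (2 * Complex.I * σ)

theorem sNum_eq {z : ℂ} (hz : z ≠ 0) (σ : ℂ) :
    sNum σ z = 2 * Complex.I * z * (sfun z - σ) := by
  rw [sNum, ← sfun_eq hz]; ring

theorem sNum_add_ne_zero {σ γ z : ℂ} {b : ℝ} (hσ : ‖2 * Complex.I * σ‖ ≤ b)
    (h : ‖z‖ ^ 2 + ‖z‖ * (b + 4 * ‖γ‖) < 1) : sNum (σ + 2 * γ) z ≠ 0 := by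
  intro h0
  have h1 : (1 : ℂ) = z ^ 2 - z * (2 * Complex.I * σ + 4 * Complex.I * γ) := by
    rw [sNum] at h0; linear_combination -h0
  have h2 : ‖2 * Complex.I * σ + 4 * Complex.I * γ‖ ≤ b + 4 * ‖γ‖ :=
    (norm_add_le _ _).trans (add_le_add hσ (by simp))
  have h3 : (1 : ℝ) ≤ ‖z‖ ^ 2 + ‖z‖ * (b + 4 * ‖γ‖) := by
    calc (1 : ℝ) = ‖(1 : ℂ)‖ := by simp
      _ ≤ ‖z ^ 2‖ + ‖z * (2 * Complex.I * σ + 4 * Complex.I * γ)‖ := by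
        rw [h1]; exact norm_sub_le _ _
      _ ≤ _ := by
        rw [norm_pow, norm_mul]; gcongr
  linarith

theorem sfun_sub_eq {z : ℂ} (hz : z ≠ 0) (σ : ℂ) :
    sfun z - σ = sNum σ z / (2 * Complex.I * z) := by
  rw [sNum_eq hz, mul_div_cancel_left₀]
  simp [hz]

theorem sfun_sub_ne_zero {σ γ z : ℂ} (hz : z ≠ 0) (h : sNum (σ + 2 * γ) z ≠ 0) :
    sfun z - σ - 2 * γ ≠ 0 := by
  rw [sub_sub, sfun_sub_eq hz]
  exact div_ne_zero h (by simp [hz])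

theorem sfun_div_eq {z : ℂ} (hz : z ≠ 0) (σ γ : ℂ) :
    (sfun z - σ) / (sfun z - σ - 2 * γ) = sNum σ z / sNum (σ + 2 * γ) z := by
  rw [sub_sub, sfun_sub_eq hz, sfun_sub_eq hz, div_div_div_cancel_right₀]
  simp [hz]

theorem Y4_sfun_eq {z : ℂ} (hz : z ≠ 0) (γ σ : ℂ) (j l : Fin 4) (v : V4) (b : Fin 4 → Spin) :
    Y4 γ j l (sfun z - σ) v b
      = (sNum σ z * Pi4 j l v b - 4 * Complex.I * γ * z * v b) / sNum (σ + 2 * γ) z := by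
  have h : 2 * Complex.I * z ≠ 0 := by simp [hz]
  rw [Y4, ← mul_div_mul_left _ _ h, sNum_eq hz, sNum_eq hz]
  congr 1 <;> ring

/-- The analytic continuation of `z ↦ 2iz (s(z) - s(w/z))` across `z = 0`. -/
noncomputable def pairNum (w z : ℂ) : ℂ := z ^ 2 - 1 - w + z ^ 2 / w

theorem sNum_sfun_div {z w : ℂ} (hz : z ≠ 0) (hw : w ≠ 0) (γ : ℂ) :
    sNum (sfun (w / z) + 2 * γ) z = pairNum w z - 4 * Complex.I * γ * z := by
  have := Complex.I_ne_zero
  rw [sNum, pairNum, sfun]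
  field_simp
  ring

theorem pairNum_sub_ne_zero {γ z w : ℂ}
    (h : ‖z‖ ^ 2 + ‖w‖ + ‖z‖ ^ 2 / ‖w‖ + 4 * ‖γ‖ * ‖z‖ < 1) :
    pairNum w z - 4 * Complex.I * γ * z ≠ 0 := by
  intro h0
  have h1 : (1 : ℂ) = z ^ 2 - w + z ^ 2 / w - 4 * Complex.I * γ * z := by
    rw [pairNum] at h0; linear_combination -h0
  have h2 : (1 : ℝ) ≤ ‖z‖ ^ 2 + ‖w‖ + ‖z‖ ^ 2 / ‖w‖ + 4 * ‖γ‖ * ‖z‖ := by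
    calc (1 : ℝ) = ‖z ^ 2 - w + z ^ 2 / w - 4 * Complex.I * γ * z‖ := by rw [← h1]; simp
      _ ≤ ‖z ^ 2‖ + ‖w‖ + ‖z ^ 2 / w‖ + ‖4 * Complex.I * γ * z‖ :=
        (norm_sub_le _ _).trans (add_le_add_left ((norm_add_le _ _).trans
          (add_le_add_left (norm_sub_le _ _) _)) _)
      _ = _ := by simp
  linarith

/-- The integrand of the quadruple contour integral. -/
noncomputable def integrand (γ : ℂ) (a : Fin 4 → Spin) (n q p m : ℤ) (z1 z2 z3 z4 : ℂ) : ℂ :=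
  Y4 γ 2 3 (sfun z1 - sfun z3) (Y4 γ 1 2 (sfun z1 - sfun z4) I4) a *
    ((sfun z1 - sfun z2) / (sfun z1 - sfun z2 - 2 * γ)) *
    ((sfun z3 - sfun z4) / (sfun z3 - sfun z4 - 2 * γ)) *
    (z2 ^ n * z4 ^ q * z3 ^ p * z1 ^ m)

theorem integrand_div_eq {γ z w z3 z4 : ℂ} (hz : z ≠ 0) (hw : w ≠ 0) (a : Fin 4 → Spin)
    (n q p : ℤ) (k : ℕ) :
    integrand γ a n q p (n + 1 + k) z (w / z) z3 z4 / z =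
      (sNum (sfun z3) z * ((sNum (sfun z4) z * Pi4 1 2 I4 (a ∘ Equiv.swap 2 3)
            - 4 * Complex.I * γ * z * I4 (a ∘ Equiv.swap 2 3)) / sNum (sfun z4 + 2 * γ) z)
          - 4 * Complex.I * γ * z * ((sNum (sfun z4) z * Pi4 1 2 I4 a
            - 4 * Complex.I * γ * z * I4 a) / sNum (sfun z4 + 2 * γ) z))
        / sNum (sfun z3 + 2 * γ) z *
      (pairNum w z / (pairNum w z - 4 * Complex.I * γ * z)) *
      ((sfun z3 - sfun z4) / (sfun z3 - sfun z4 - 2 * γ)) *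
      (w ^ n * z4 ^ q * z3 ^ p * z ^ k) := by
  have h0 : sNum (sfun (w / z)) z = pairNum w z := by
    simpa using sNum_sfun_div hz hw 0
  have h1 : (w / z) ^ n * z4 ^ q * z3 ^ p * z ^ (n + 1 + k : ℤ)
      = w ^ n * z4 ^ q * z3 ^ p * z ^ k * z := by
    rw [div_zpow, zpow_add₀ hz, zpow_add₀ hz, zpow_one, zpow_natCast]
    field_simp [zpow_ne_zero n hz]
  rw [integrand, Y4_sfun_eq hz, sfun_div_eq hz, h0, sNum_sfun_div hz hw, Pi4, Y4_sfun_eq hz,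
    Y4_sfun_eq hz, h1, ← mul_assoc, mul_div_cancel_right₀ _ hz]

theorem differentiable_sNum (σ : ℂ) : Differentiable ℂ (sNum σ) := by
  unfold sNum; fun_prop

theorem differentiable_pairNum (w : ℂ) : Differentiable ℂ (pairNum w) := by
  unfold pairNum; fun_prop

theorem cint_integrand_eq_zero {γ w z3 z4 : ℂ} {ρ : ℝ} (hρ : 0 < ρ) (hw : w ≠ 0)
    (h2 : ∀ z, ‖z‖ ≤ ρ → pairNum w z - 4 * Complex.I * γ * z ≠ 0)
    (h3 : ∀ z, ‖z‖ ≤ ρ → sNum (sfun z3 + 2 * γ) z ≠ 0)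
    (h4 : ∀ z, ‖z‖ ≤ ρ → sNum (sfun z4 + 2 * γ) z ≠ 0)
    (a : Fin 4 → Spin) (n q p : ℤ) (k : ℕ) :
    cint ρ (fun z => integrand γ a n q p (n + 1 + k) z (w / z) z3 z4) = 0 := by
  rw [cint, circleIntegral.integral_congr hρ.le fun z hz => integrand_div_eq (z := z)
    (norm_pos_iff.1 (mem_sphere_zero_iff_norm.1 hz ▸ hρ)) hw a n q p k]
  refine mul_eq_zero_of_right _ (DiffContOnCl.circleIntegral_eq_zero hρ.le
    (DifferentiableOn.diffContOnCl fun z hz => ?_))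
  rw [closure_ball _ hρ.ne', mem_closedBall_zero_iff] at hz
  have d3 := (differentiable_sNum (sfun z3)) z
  have d4 := (differentiable_sNum (sfun z4)) z
  have d3' := (differentiable_sNum (sfun z3 + 2 * γ)) z
  have d4' := (differentiable_sNum (sfun z4 + 2 * γ)) z
  have d2 := (differentiable_pairNum w) z
  have := h2 z hz
  have := h3 z hz
  have := h4 z hz
  apply DifferentiableAt.differentiableWithinAt
  fun_prop (disch := assumption)

theorem continuous_sfun_comp {X : Type*} [TopologicalSpace X] {f : X → ℂ} (hf : Continuous f)
    (h0 : ∀ x, f x ≠ 0) : Continuous fun x => sfun (f x) := by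
  unfold sfun
  fun_prop (disch := assumption)

theorem continuous_integrand {X : Type*} [TopologicalSpace X] {γ : ℂ} {f1 f2 f3 f4 : X → ℂ}
    (c1 : Continuous f1) (c2 : Continuous f2) (c3 : Continuous f3) (c4 : Continuous f4)
    (h1 : ∀ x, f1 x ≠ 0) (h2 : ∀ x, f2 x ≠ 0) (h3 : ∀ x, f3 x ≠ 0) (h4 : ∀ x, f4 x ≠ 0)
    (h12 : ∀ x, sfun (f1 x) - sfun (f2 x) - 2 * γ ≠ 0)
    (h13 : ∀ x, sfun (f1 x) - sfun (f3 x) - 2 * γ ≠ 0)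
    (h14 : ∀ x, sfun (f1 x) - sfun (f4 x) - 2 * γ ≠ 0)
    (h34 : ∀ x, sfun (f3 x) - sfun (f4 x) - 2 * γ ≠ 0)
    (a : Fin 4 → Spin) (n q p m : ℤ) :
    Continuous fun x => integrand γ a n q p m (f1 x) (f2 x) (f3 x) (f4 x) := by
  have s1 := continuous_sfun_comp c1 h1
  have s2 := continuous_sfun_comp c2 h2
  have s3 := continuous_sfun_comp c3 h3
  have s4 := continuous_sfun_comp c4 h4
  have e1 := c1.zpow₀ m fun x => Or.inl (h1 x)
  have e2 := c2.zpow₀ n fun x => Or.inl (h2 x)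
  have e3 := c3.zpow₀ p fun x => Or.inl (h3 x)
  have e4 := c4.zpow₀ q fun x => Or.inl (h4 x)
  unfold integrand Y4 Pi4
  beta_reduce
  fun_prop (disch := assumption)

/-- A quadruple normalized contour integral vanishes as soon as the substitution `w = z₁ z₂`
makes the integral over `z₁` vanish. -/
theorem cint_four_eq_zero {ρ₁ ρ₂ ρ₃ ρ₄ : ℝ} (h₁ : 0 < ρ₁) (h₂ : 0 < ρ₂) (h₃ : 0 < ρ₃)
    (h₄ : 0 < ρ₄) {F : ℂ → ℂ → ℂ → ℂ → ℂ}
    (hF : Continuous fun t : ℝ × ℝ × ℝ × ℝ => F (circleMap 0 ρ₁ t.1)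
      (circleMap 0 (ρ₁ * ρ₂) t.2.1 / circleMap 0 ρ₁ t.1) (circleMap 0 ρ₃ t.2.2.1)
      (circleMap 0 ρ₄ t.2.2.2))
    (h0 : ∀ w z3 z4, ‖w‖ = ρ₁ * ρ₂ → ‖z3‖ = ρ₃ → ‖z4‖ = ρ₄ →
      cint ρ₁ (fun z => F z (w / z) z3 z4) = 0) :
    (cint ρ₁ fun z1 => cint ρ₂ fun z2 => cint ρ₃ fun z3 => cint ρ₄ fun z4 => F z1 z2 z3 z4)
      = 0 := by
  have hw := mul_pos h₁ h₂
  have zero_of (ρ : ℝ) (hρ : 0 < ρ) (f : ℂ → ℂ) (hf : ∀ z, ‖z‖ = ρ → f z = 0) :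
      cint ρ f = 0 := by
    rw [cint_congr hρ (g := fun _ => 0) hf]; simp [cint, circleIntegral]
  rw [cint_congr h₁ fun z hz => cint_eq_cint_div h₁ h₂ hz _, cint_comm h₁.ne' hw.ne']
  · refine zero_of _ hw _ fun w hw' => ?_
    obtain ⟨θ, rfl⟩ : ∃ θ, circleMap 0 (ρ₁ * ρ₂) θ = w :=
      ⟨w.arg, by rw [circleMap_zero, ← hw', Complex.norm_mul_exp_arg_mul_I]⟩
    rw [cint_comm h₁.ne' h₃.ne']
    · refine zero_of _ h₃ _ fun z3 hz3 => ?_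
      obtain ⟨φ, rfl⟩ : ∃ φ, circleMap 0 ρ₃ φ = z3 :=
        ⟨z3.arg, by rw [circleMap_zero, ← hz3, Complex.norm_mul_exp_arg_mul_I]⟩
      rw [cint_comm h₁.ne' h₄.ne']
      · exact zero_of _ h₄ _ fun z4 hz4 => h0 _ _ _ hw' hz3 hz4
      · exact hF.comp (g := _) (f := fun t : ℝ × ℝ => (t.1, θ, φ, t.2)) (by fun_prop)
    · refine continuous_cint h₄.ne' ?_
      exact hF.comp (f := fun t : (ℝ × ℝ) × ℝ => (t.1.1, θ, t.1.2, t.2)) (by fun_prop)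
  · refine continuous_cint h₃.ne' (continuous_cint h₄.ne' ?_)
    exact hF.comp (f := fun t : ((ℝ × ℝ) × ℝ) × ℝ => (t.1.1.1, t.1.1.2, t.1.2, t.2))
      (by fun_prop)

/-- The contribution `T(1,3,4,2)|_{t=0}` vanishes: the quadruple contour integral with
`Y_{3,4}(s(z1)-s(z3)) Y_{2,3}(s(z1)-s(z4))` applied to `I4` is zero. -/
theorem T1342_vanishes (γ : ℂ) :
    ∃ r0 ∈ Set.Ioo (0 : ℝ) 1, ∀ r ∈ Set.Ioo (0 : ℝ) r0,
      ∀ (y1 y2 x1 x2 x3 x4 : ℤ), y1 < y2 → x1 ≤ x2 → x2 ≤ x3 → x3 ≤ x4 → x1 < x4 →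
      ∀ a : Fin 4 → Spin,
        (cint (r ^ 3) fun z1 => cint (r ^ 2) fun z2 => cint r fun z3 => cint 1 fun z4 =>
          Y4 γ 2 3 (sfun z1 - sfun z3) (Y4 γ 1 2 (sfun z1 - sfun z4) I4) a *
            ((sfun z1 - sfun z2) / (sfun z1 - sfun z2 - 2 * γ)) *
            ((sfun z3 - sfun z4) / (sfun z3 - sfun z4 - 2 * γ)) *
            (z2 ^ (x1 - y1) * z4 ^ (x2 - y2) * z3 ^ (x3 - y2) * z1 ^ (x4 - y1))) = 0 := by
  have hγ : 0 ≤ ‖γ‖ := norm_nonneg γ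
  refine ⟨1 / (10 * (1 + ‖γ‖)), ⟨by positivity, ?_⟩, ?_⟩
  · rw [div_lt_one (by positivity)]; linarith
  intro r ⟨hr, hr0⟩ y1 y2 x1 x2 x3 x4 _ _ _ _ hx a
  rw [lt_div_iff₀ (by positivity)] at hr0
  have hg : 0 ≤ r * ‖γ‖ := by positivity
  have hr1 : r < 1 / 10 := by linarith
  have hrγ : r * ‖γ‖ < 1 / 10 := by linarith
  have hsq : r ^ 2 < 1 / 100 := by nlinarith
  have hsqγ : r ^ 2 * (r * ‖γ‖) < 1 / 1000 := by nlinarith [sq_nonneg r]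
  have hp3 : r ^ 3 < 1 / 1000 := by nlinarith
  have hp4 : r ^ 4 < 1 / 1000 := by nlinarith
  have hp5 : r ^ 5 < 1 / 1000 := by nlinarith
  have hp6 : r ^ 6 < 1 / 1000 := by nlinarith
  have den2 : ∀ w, ‖w‖ = r ^ 3 * r ^ 2 → ∀ z, ‖z‖ ≤ r ^ 3 →
      pairNum w z - 4 * Complex.I * γ * z ≠ 0 := fun w hw z hz => by
    refine pairNum_sub_ne_zero ?_
    rw [hw]
    calc ‖z‖ ^ 2 + r ^ 3 * r ^ 2 + ‖z‖ ^ 2 / (r ^ 3 * r ^ 2) + 4 * ‖γ‖ * ‖z‖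
        ≤ (r ^ 3) ^ 2 + r ^ 3 * r ^ 2 + (r ^ 3) ^ 2 / (r ^ 3 * r ^ 2) + 4 * ‖γ‖ * r ^ 3 := by
          gcongr
      _ = r ^ 6 + r ^ 5 + r + 4 * (r ^ 2 * (r * ‖γ‖)) := by field_simp
      _ < 1 := by linarith
  have den3 : ∀ w, ‖w‖ = r → ∀ z, ‖z‖ ≤ r ^ 3 → sNum (sfun w + 2 * γ) z ≠ 0 :=
    fun w hw z hz => by
      refine sNum_add_ne_zero (norm_two_I_mul_sfun_le w) ?_
      rw [hw]
      calc ‖z‖ ^ 2 + ‖z‖ * (r + r⁻¹ + 4 * ‖γ‖)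
          ≤ (r ^ 3) ^ 2 + r ^ 3 * (r + r⁻¹ + 4 * ‖γ‖) := by gcongr
        _ = r ^ 6 + r ^ 4 + r ^ 2 + 4 * (r ^ 2 * (r * ‖γ‖)) := by field_simp; ring
        _ < 1 := by linarith
  have den4 : ∀ w, ‖w‖ = 1 → ∀ z, ‖z‖ ≤ r → sNum (sfun w + 2 * γ) z ≠ 0 :=
    fun w hw z hz => by
      refine sNum_add_ne_zero (norm_two_I_mul_sfun_le w) ?_
      rw [hw]
      calc ‖z‖ ^ 2 + ‖z‖ * (1 + 1⁻¹ + 4 * ‖γ‖)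
          ≤ r ^ 2 + r * (1 + 1⁻¹ + 4 * ‖γ‖) := by gcongr
        _ = r ^ 2 + 2 * r + 4 * (r * ‖γ‖) := by ring
        _ < 1 := by linarith
  have hr3 : r ^ 3 ≤ r := by nlinarith
  have norm_circle {ρ : ℝ} (hρ : 0 < ρ) (θ : ℝ) : ‖circleMap 0 ρ θ‖ = ρ := by
    rw [norm_circleMap_zero, abs_of_pos hρ]
  have p3 : 0 < r ^ 3 := by positivity
  have p5 : 0 < r ^ 3 * r ^ 2 := by positivity
  have ne {ρ : ℝ} (hρ : 0 < ρ) (θ : ℝ) : circleMap 0 ρ θ ≠ 0 := circleMap_ne_center hρ.ne'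
  refine cint_four_eq_zero p3 (by positivity) hr one_pos
    (F := integrand γ a (x1 - y1) (x2 - y2) (x3 - y2) (x4 - y1)) ?_ ?_
  · refine continuous_integrand (by fun_prop) ?_ (by fun_prop) (by fun_prop)
      (fun _ => ne p3 _) (fun _ => div_ne_zero (ne p5 _) (ne p3 _)) (fun _ => ne hr _)
      (fun _ => ne one_pos _) (fun _ => sfun_sub_ne_zero (ne p3 _) ?_)
      (fun _ => sfun_sub_ne_zero (ne p3 _)
        (den3 _ (norm_circle hr _) _ (norm_circle p3 _).le))
      (fun _ => sfun_sub_ne_zero (ne p3 _)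
        (den4 _ (norm_circle one_pos _) _ ((norm_circle p3 _).le.trans hr3)))
      (fun _ => sfun_sub_ne_zero (ne hr _)
        (den4 _ (norm_circle one_pos _) _ (norm_circle hr _).le)) _ _ _ _ _
    · exact Continuous.div (by fun_prop) (by fun_prop) fun _ => ne p3 _
    · rw [sNum_sfun_div (ne p3 _) (ne p5 _)]
      exact den2 _ (norm_circle p5 _) _ (norm_circle p3 _).le
  · intro w z3 z4 hw h3 h4
    obtain ⟨k, hk⟩ := Int.le.dest (Int.add_one_le_of_lt hx)
    rw [show x4 - y1 = x1 - y1 + 1 + k by omega]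
    exact cint_integrand_eq_zero p3 (norm_pos_iff.1 (hw ▸ p5)) (den2 w hw) (den3 z3 h3)
      (fun z hz => den4 z4 h4 z (hz.trans hr3)) a _ _ _ k
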